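/- Fix an integer t ≥ 2. Let q_0 be the unique dominant simple pole of the forest generating function H(q,1,1,1) and let Q < 1 be as in the dominant-singularity lemma. For r ≥ 1 define ν(r) = a(q_0,1,1,1)/(q_0 · ∂b/∂q(q,1,1,1)|_{q=q_0}), where a is taken with r roots. Then ν(r) = Θ(1) uniformly in r ≥ 1, and the number of canonical t-ary forests with r roots and n internal vertices equals (ν(r)/q_0^n)·(1 + O(Q^n)), with the O-constant uniform in r ≥ 1. -/

import Mathlib

open scoped BigOperators
open Filter MeasureTheory

noncomputable section

/-- `hp t j = 1 + t + ⋯ + t^(j-1) = (t^j - 1)/(t-1)`. -/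
def hp (t j : ℕ) : ℕ := ∑ i ∈ Finset.range j, t ^ i

/-- The series `b(q,u,v,w)`
`b = Σ_{j≥1} v q^{h_j} u^{t^j} w^j/(1−q^{h_j} u^{t^j}) ∏_{i=1}^{j−1} (1−v−q^{h_i}u^{t^i})/(1−q^{h_i}u^{t^i})`. -/
def bGF (t : ℕ) (q u v w : ℂ) : ℂ :=
  ∑' j : ℕ,
    v * q ^ hp t (j + 1) * u ^ t ^ (j + 1) * w ^ (j + 1) /
        (1 - q ^ hp t (j + 1) * u ^ t ^ (j + 1)) *
      ∏ i ∈ Finset.Icc 1 j,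
        (1 - v - q ^ hp t i * u ^ t ^ i) / (1 - q ^ hp t i * u ^ t ^ i)

/-- The series `a(q,u,v,w)` (for canonical forests with `r` roots)
`a = Σ_{j≥0} v q^{r h_j} u^{r t^j} w^j ∏_{i=1}^{j} (1−v−q^{h_i}u^{t^i})/(1−q^{h_i}u^{t^i})`. -/
def aGF (t r : ℕ) (q u v w : ℂ) : ℂ :=
  ∑' j : ℕ,
    v * q ^ (r * hp t j) * u ^ (r * t ^ j) * w ^ j *
      ∏ i ∈ Finset.Icc 1 j,
        (1 - v - q ^ hp t i * u ^ t ^ i) / (1 - q ^ hp t i * u ^ t ^ i)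

/-- A canonical `t`-ary forest with `r` (ordered) roots, encoded by its sequence of
numbers of internal vertices on each level (a canonical forest is uniquely determined
by this sequence: on each level the leaves come first, since outdegrees read from left
to right are non-decreasing).  The number `c_0` of internal vertices on level `0` is at
most `r`, each level's internal-vertex count satisfies `1 ≤ c_{k+1} ≤ t·c_k`, and the
list stops at the last level containing internal vertices. -/
structure CanonicalForest (t r : ℕ) where
  levels : List ℕ
  pos : ∀ c ∈ levels, 0 < c
  head_le : ∀ c ∈ levels.head?, c ≤ r
  chain : levels.Chain' fun a b => b ≤ t * a

namespace CanonicalForest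

variable {t r : ℕ} (T : CanonicalForest t r)

/-- the number `n(T)` of internal vertices -/
def size : ℕ := T.levels.sum

/-- the height `h(T)`: the maximal distance of a leaf from the root level -/
def height : ℕ := T.levels.length

/-- the number of internal vertices at depth `k` -/
def internAt (k : ℕ) : ℕ := T.levels.getD k 0

/-- the number of vertices at depth `k` -/
def vertsAt (k : ℕ) : ℕ := if k = 0 then r else t * T.internAt (k - 1)

/-- the number of leaves at depth `k` -/
def leavesAt (k : ℕ) : ℕ := T.vertsAt k - T.internAt k

/-- the number `m(T)` of leaves at maximal depth -/
def lastLeaves : ℕ := T.vertsAt T.height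

/-- the number `d(T)` of distinct depths at which leaves occur -/
def distinctDepths : ℕ :=
  ((Finset.range (T.height + 1)).filter fun k => 0 < T.leavesAt k).card

/-- the (leaf-)width `w(T)`: the maximal number of leaves on one level -/
def width : ℕ := (Finset.range (T.height + 1)).sup fun k => T.leavesAt k

/-- the total path length `ℓ(T)`: the sum of the depths of all vertices -/
def pathLength : ℕ := ∑ k ∈ Finset.range (T.height + 1), k * T.vertsAt k

end CanonicalForest

/-- the number of canonical `t`-ary forests with `r` roots and `n` internal vertices -/
def forestCount (t r n : ℕ) : ℕ := Nat.card {T : CanonicalForest t r // T.size = n}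

/-- the probability of an event under the uniform distribution on canonical `t`-ary
forests with `r` roots and `n` internal vertices -/
def forestProb (t r n : ℕ) (s : Set (CanonicalForest t r)) : ℝ :=
  (Nat.card {T : CanonicalForest t r // T.size = n ∧ T ∈ s} : ℝ) / forestCount t r n

/-- the expectation of a random variable under the uniform distribution on canonical
`t`-ary forests with `r` roots and `n` internal vertices -/
def forestExp (t r n : ℕ) (f : CanonicalForest t r → ℝ) : ℝ :=
  (∑ᶠ T : {T : CanonicalForest t r // T.size = n}, f T.1) / forestCount t r n

/-- the variance of a random variable under the uniform distribution on canonical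
`t`-ary forests with `r` roots and `n` internal vertices -/
def forestVar (t r n : ℕ) (f : CanonicalForest t r → ℝ) : ℝ :=
  forestExp t r n (fun T => f T ^ 2) - forestExp t r n f ^ 2

/-- the distribution function of the standard normal distribution -/
def stdGaussCDF (x : ℝ) : ℝ :=
  (Real.sqrt (2 * Real.pi))⁻¹ * ∫ u in Set.Iic x, Real.exp (-u ^ 2 / 2)

/-- the density of the standard normal distribution -/
def stdGaussPDF (x : ℝ) : ℝ :=
  (Real.sqrt (2 * Real.pi))⁻¹ * Real.exp (-x ^ 2 / 2)


/-- `ν(r) = a(q₀,1,1,1) / (q₀ · ∂b/∂q(q,1,1,1)|_{q=q₀})`, where `a` is taken with `r` roots. -/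
def nuGF (t r : ℕ) (q₀ : ℝ) : ℂ :=
  aGF t r (q₀ : ℂ) 1 1 1 / ((q₀ : ℂ) * deriv (fun q : ℂ => bGF t q 1 1 1) (q₀ : ℂ))


/-! ### Auxiliary products -/

def WW (t i : ℕ) (z : ℂ) : ℂ := z ^ hp t i / (1 - z ^ hp t i)

def PP (t j : ℕ) (z : ℂ) : ℂ := ∏ i ∈ Finset.range j, WW t (i + 1) z

def wr (t i : ℕ) (x : ℝ) : ℝ := x ^ hp t i / (1 - x ^ hp t i)

def pr (t j : ℕ) (x : ℝ) : ℝ := ∏ i ∈ Finset.range j, wr t (i + 1) x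

lemma hp_succ (t j : ℕ) : hp t (j + 1) = t * hp t j + 1 := by
  simp [hp, geom_sum_succ]

lemma hp_zero (t : ℕ) : hp t 0 = 0 := by simp [hp]

lemma hp_one (t : ℕ) : hp t 1 = 1 := by simp [hp]

lemma hp_two (t : ℕ) : hp t 2 = t + 1 := by rw [hp_succ, hp_one]; ring

lemma hp_three (t : ℕ) : hp t 3 = t * (t + 1) + 1 := by rw [hp_succ, hp_two]

lemma hp_succ_pos (t j : ℕ) : 0 < hp t (j + 1) := by rw [hp_succ]; omega

lemma hp_mono (t : ℕ) : Monotone (hp t) := by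
  apply monotone_nat_of_le_succ
  intro n
  simp [hp, Finset.sum_range_succ]

lemma le_hp (t j : ℕ) (ht : 1 ≤ t) : j ≤ hp t j := by
  induction j with
  | zero => simp
  | succ j ih => rw [hp_succ]; nlinarith

lemma wr_nonneg (t i : ℕ) {x : ℝ} (h0 : 0 ≤ x) (h1 : x < 1) : 0 ≤ wr t i x := by
  unfold wr
  have : x ^ hp t i ≤ 1 := pow_le_one₀ h0 h1.le
  exact div_nonneg (by positivity) (by linarith)

lemma wr_pos (t i : ℕ) {x : ℝ} (h0 : 0 < x) (h1 : x < 1) : 0 < wr t (i + 1) x := by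
  unfold wr
  have : x ^ hp t (i + 1) < 1 := pow_lt_one₀ h0.le h1 (hp_succ_pos t i).ne'
  exact div_pos (by positivity) (by linarith)

lemma pr_pos (t j : ℕ) {x : ℝ} (h0 : 0 < x) (h1 : x < 1) : 0 < pr t j x :=
  Finset.prod_pos fun i _ => wr_pos t i h0 h1

lemma pr_succ (t j : ℕ) (x : ℝ) : pr t (j + 1) x = pr t j x * wr t (j + 1) x := by
  simp [pr, Finset.prod_range_succ]

lemma PP_succ (t j : ℕ) (x : ℂ) : PP t (j + 1) x = PP t j x * WW t (j + 1) x := by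
  simp [PP, Finset.prod_range_succ]

lemma PP_ofReal (t j : ℕ) (x : ℝ) : PP t j (x : ℂ) = (pr t j x : ℂ) := by
  simp [PP, pr, WW, wr]

lemma div_one_sub_mono {a b : ℝ} (hab : a ≤ b) (hb : b < 1) :
    a / (1 - a) ≤ b / (1 - b) := by
  rw [div_le_div_iff₀ (by linarith) (by linarith)]
  nlinarith

lemma wr_anti (t : ℕ) {x : ℝ} (h0 : 0 < x) (h1 : x < 1) {i j : ℕ} (hij : i ≤ j) :
    wr t (j + 1) x ≤ wr t (i + 1) x := by
  unfold wr
  apply div_one_sub_mono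
  · exact pow_le_pow_of_le_one h0.le h1.le (hp_mono t (by omega))
  · exact pow_lt_one₀ h0.le h1 (hp_succ_pos t i).ne'

lemma one_sub_pow_ne (t i : ℕ) {z : ℂ} (hz : ‖z‖ < 1) : 1 - z ^ hp t (i + 1) ≠ 0 := by
  intro h
  have h2 : z ^ hp t (i + 1) = 1 := (sub_eq_zero.mp h).symm
  have h3 : ‖z‖ ^ hp t (i + 1) < 1 := pow_lt_one₀ (norm_nonneg _) hz (hp_succ_pos t i).ne'
  rw [← norm_pow, h2, norm_one] at h3
  exact lt_irrefl _ h3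

lemma norm_WW_le (t i : ℕ) {z : ℂ} {ρ : ℝ} (hz : ‖z‖ ≤ ρ) (hρ : ρ < 1) :
    ‖WW t (i + 1) z‖ ≤ wr t (i + 1) ρ := by
  unfold WW wr
  have h0 : 0 ≤ ‖z‖ := norm_nonneg _
  have h1 : ‖z‖ ^ hp t (i + 1) ≤ ρ ^ hp t (i + 1) := pow_le_pow_left₀ h0 hz _
  have h2 : ρ ^ hp t (i + 1) < 1 := pow_lt_one₀ (h0.trans hz) hρ (hp_succ_pos t i).ne'
  have h3 : 1 - ρ ^ hp t (i + 1) ≤ ‖1 - z ^ hp t (i + 1)‖ := by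
    have := norm_sub_norm_le (1 : ℂ) (z ^ hp t (i + 1))
    rw [norm_one, norm_pow] at this
    linarith
  rw [norm_div, norm_pow]
  exact div_le_div₀ (by positivity [h0.trans hz]) h1 (by linarith) h3

lemma norm_PP_le (t j : ℕ) {z : ℂ} {ρ : ℝ} (hz : ‖z‖ ≤ ρ) (hρ : ρ < 1) :
    ‖PP t j z‖ ≤ pr t j ρ := by
  unfold PP pr
  rw [norm_prod]
  exact Finset.prod_le_prod (fun i _ => norm_nonneg _) fun i _ => norm_WW_le t i hz hρ

lemma tendsto_pow_hp (t : ℕ) (ht : 2 ≤ t) {ρ : ℝ} (h0 : 0 < ρ) (h1 : ρ < 1) :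
    Tendsto (fun j => ρ ^ hp t (j + 1)) atTop (nhds 0) := by
  have : Tendsto (fun j => hp t (j + 1)) atTop atTop :=
    tendsto_atTop_mono (fun j => (Nat.le_succ j).trans (le_hp t (j + 1) (by omega))) tendsto_id
  exact (tendsto_pow_atTop_nhds_zero_of_lt_one h0.le h1).comp this

lemma tendsto_wr (t : ℕ) (ht : 2 ≤ t) {ρ : ℝ} (h0 : 0 < ρ) (h1 : ρ < 1) :
    Tendsto (fun j => wr t (j + 1) ρ) atTop (nhds 0) := by
  have h := tendsto_pow_hp t ht h0 h1
  have h2 := h.div (h.const_sub 1) (by norm_num)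
  rw [zero_div] at h2
  exact h2

lemma pr_summable (t : ℕ) (ht : 2 ≤ t) {ρ : ℝ} (h0 : 0 < ρ) (h1 : ρ < 1) :
    Summable (fun j => pr t j ρ) := by
  apply summable_of_ratio_test_tendsto_lt_one (l := 0) one_pos
  · exact Eventually.of_forall fun j => (pr_pos t j h0 h1).ne'
  · refine (tendsto_wr t ht h0 h1).congr fun j => ?_
    rw [pr_succ, Real.norm_of_nonneg (mul_pos (pr_pos t j h0 h1) (wr_pos t j h0 h1)).le,
      Real.norm_of_nonneg (pr_pos t j h0 h1).le]
    field_simp [(pr_pos t j h0 h1).ne']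

lemma prod_Icc_eq (t j : ℕ) (z : ℂ) :
    ∏ i ∈ Finset.Icc 1 j, (1 - 1 - z ^ hp t i * 1 ^ t ^ i) / (1 - z ^ hp t i * 1 ^ t ^ i)
      = (-1) ^ j * PP t j z := by
  induction j with
  | zero => simp [PP]
  | succ j ih =>
    rw [Finset.prod_Icc_succ_top (by omega), ih, PP_succ]
    simp only [WW, one_pow, mul_one]
    ring

lemma bGF_eq (t : ℕ) (z : ℂ) :
    bGF t z 1 1 1 = ∑' j : ℕ, (-1) ^ j * PP t (j + 1) z := by
  unfold bGF
  congr 1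
  ext j
  rw [prod_Icc_eq, PP_succ]
  simp only [WW, one_pow, mul_one, one_mul]
  ring

lemma aGF_eq (t r : ℕ) (z : ℂ) :
    aGF t r z 1 1 1 = ∑' j : ℕ, (-1) ^ j * (z ^ (r * hp t j) * PP t j z) := by
  unfold aGF
  congr 1
  ext j
  rw [prod_Icc_eq]
  simp only [one_pow, mul_one, one_mul]
  ring

lemma norm_bterm_le (t j : ℕ) {z : ℂ} {ρ : ℝ} (hz : ‖z‖ ≤ ρ) (hρ : ρ < 1) :
    ‖(-1) ^ j * PP t (j + 1) z‖ ≤ pr t (j + 1) ρ := by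
  simpa using norm_PP_le t (j + 1) hz hρ

lemma norm_aterm_le (t r j : ℕ) {z : ℂ} {ρ : ℝ} (hz : ‖z‖ ≤ ρ) (hρ : ρ < 1) :
    ‖(-1) ^ j * (z ^ (r * hp t j) * PP t j z)‖ ≤ pr t j ρ := by
  have h1 := norm_PP_le t j hz hρ
  have h2 : ‖z‖ ^ (r * hp t j) ≤ 1 := pow_le_one₀ (norm_nonneg _) (hz.trans hρ.le)
  simp only [norm_mul, norm_pow, norm_neg, norm_one, one_pow, one_mul]
  calc _ ≤ 1 * ‖PP t j z‖ := by gcongr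
    _ ≤ _ := by simpa using h1

lemma exists_between_rho {z : ℂ} (hz : ‖z‖ < 1) : ∃ ρ : ℝ, 0 < ρ ∧ ρ < 1 ∧ ‖z‖ < ρ := by
  obtain ⟨ρ, h1, h2⟩ := exists_between hz
  exact ⟨ρ, (norm_nonneg z).trans_lt h1, h2, h1⟩

lemma summable_b (t : ℕ) (ht : 2 ≤ t) {z : ℂ} (hz : ‖z‖ < 1) :
    Summable fun j : ℕ => (-1) ^ j * PP t (j + 1) z := by
  obtain ⟨ρ, h0, h1, h2⟩ := exists_between_rho hz
  exact Summable.of_norm_bounded ((summable_nat_add_iff 1).mpr (pr_summable t ht h0 h1))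
    fun j => norm_bterm_le t j h2.le h1

lemma summable_a (t r : ℕ) (ht : 2 ≤ t) {z : ℂ} (hz : ‖z‖ < 1) :
    Summable fun j : ℕ => (-1) ^ j * (z ^ (r * hp t j) * PP t j z) := by
  obtain ⟨ρ, h0, h1, h2⟩ := exists_between_rho hz
  exact Summable.of_norm_bounded (pr_summable t ht h0 h1)
    fun j => norm_aterm_le t r j h2.le h1

lemma differentiableAt_PP (t j : ℕ) {z : ℂ} (hz : ‖z‖ < 1) :
    DifferentiableAt ℂ (PP t j) z := by
  unfold PP
  apply DifferentiableAt.fun_finsetProd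
  intro i _
  unfold WW
  exact DifferentiableAt.fun_div (by fun_prop) (by fun_prop) (one_sub_pow_ne t i hz)

lemma differentiableAt_b (t : ℕ) (ht : 2 ≤ t) {z : ℂ} (hz : ‖z‖ < 1) :
    DifferentiableAt ℂ (fun q => bGF t q 1 1 1) z := by
  obtain ⟨ρ, h0, h1, h2⟩ := exists_between_rho hz
  simp only [bGF_eq]
  have hd : DifferentiableOn ℂ (fun q => ∑' j : ℕ, (-1) ^ j * PP t (j + 1) q)
      (Metric.ball 0 ρ) := by
    refine Complex.differentiableOn_tsum_of_summable_norm
      ((summable_nat_add_iff 1).mpr (pr_summable t ht h0 h1)) ?_ Metric.isOpen_ball ?_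
    · intro j w hw
      have hw' : ‖w‖ < ρ := by simpa using hw
      exact ((differentiableAt_PP t (j + 1) (hw'.trans h1)).const_mul _).differentiableWithinAt
    · intro j w hw
      have hw' : ‖w‖ < ρ := by simpa using hw
      exact norm_bterm_le t j hw'.le h1
  exact hd.differentiableAt (Metric.isOpen_ball.mem_nhds (by simpa using h2))

lemma differentiableAt_a (t r : ℕ) (ht : 2 ≤ t) {z : ℂ} (hz : ‖z‖ < 1) :
    DifferentiableAt ℂ (fun q => aGF t r q 1 1 1) z := by
  obtain ⟨ρ, h0, h1, h2⟩ := exists_between_rho hz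
  simp only [aGF_eq]
  have hd : DifferentiableOn ℂ
      (fun q => ∑' j : ℕ, (-1) ^ j * (q ^ (r * hp t j) * PP t j q)) (Metric.ball 0 ρ) := by
    refine Complex.differentiableOn_tsum_of_summable_norm
      (pr_summable t ht h0 h1) ?_ Metric.isOpen_ball ?_
    · intro j w hw
      have hw' : ‖w‖ < ρ := by simpa using hw
      have := differentiableAt_PP t j (hw'.trans h1)
      exact (DifferentiableAt.const_mul (DifferentiableAt.fun_mul (by fun_prop) this)
        _).differentiableWithinAt
    · intro j w hw
      have hw' : ‖w‖ < ρ := by simpa using hw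
      exact norm_aterm_le t r j hw'.le h1
  exact hd.differentiableAt (Metric.isOpen_ball.mem_nhds (by simpa using h2))

lemma hasSum_deriv_b (t : ℕ) (ht : 2 ≤ t) {z : ℂ} (hz : ‖z‖ < 1) :
    HasSum (fun j : ℕ => deriv (fun q => (-1) ^ j * PP t (j + 1) q) z)
      (deriv (fun q => bGF t q 1 1 1) z) := by
  obtain ⟨ρ, h0, h1, h2⟩ := exists_between_rho hz
  simp only [bGF_eq]
  refine Complex.hasSum_deriv_of_summable_norm (U := Metric.ball 0 ρ)
      ((summable_nat_add_iff 1).mpr (pr_summable t ht h0 h1)) ?_ Metric.isOpen_ball ?_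
      (by simpa using h2)
  · intro j w hw
    have hw' : ‖w‖ < ρ := by simpa using hw
    exact ((differentiableAt_PP t (j + 1) (hw'.trans h1)).const_mul _).differentiableWithinAt
  · intro j w hw
    have hw' : ‖w‖ < ρ := by simpa using hw
    exact norm_bterm_le t j hw'.le h1

lemma norm_a_le (t r : ℕ) (ht : 2 ≤ t) {z : ℂ} {ρ : ℝ} (h0 : 0 < ρ) (hz : ‖z‖ ≤ ρ)
    (h1 : ρ < 1) : ‖aGF t r z 1 1 1‖ ≤ ∑' j, pr t j ρ := by
  rw [aGF_eq]
  exact tsum_of_norm_bounded (pr_summable t ht h0 h1).hasSum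
    fun j => norm_aterm_le t r j hz h1

/-- The functional equation behind `H = a / (1 - b)`. -/
lemma a_functional (t r : ℕ) (ht : 2 ≤ t) {z : ℂ} (hz : ‖z‖ < 1) :
    aGF t r z 1 1 1 = 1 - bGF t z 1 1 1
      + ∑ c ∈ Finset.Icc 1 r, z ^ c * aGF t (t * c) z 1 1 1 := by
  have key : ∀ j, ∑ c ∈ Finset.Icc 1 r, z ^ c * ((-1) ^ j * (z ^ (t * c * hp t j) * PP t j z))
      = (-1) ^ j * PP t (j + 1) z
        + (-1) ^ (j + 1) * (z ^ (r * hp t (j + 1)) * PP t (j + 1) z) := by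
    intro j
    have h1 : ∀ s : ℕ, ∑ c ∈ Finset.Icc 1 s, z ^ c * ((-1) ^ j * (z ^ (t * c * hp t j) * PP t j z))
      = (-1) ^ j * PP t j z * (WW t (j + 1) z * (1 - z ^ (s * hp t (j + 1)))) := by
      intro s
      induction s with
      | zero => simp
      | succ s ih =>
        rw [Finset.sum_Icc_succ_top (by omega), ih]
        have e : z ^ (s + 1) * z ^ (t * (s + 1) * hp t j) = z ^ ((s + 1) * hp t (j + 1)) := by
          rw [← pow_add]; congr 1; rw [hp_succ]; ring
        have e2 : WW t (j + 1) z * (1 - z ^ ((s + 1) * hp t (j + 1)))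
            = WW t (j + 1) z * (1 - z ^ (s * hp t (j + 1))) + z ^ ((s + 1) * hp t (j + 1)) := by
          have e3 : z ^ ((s + 1) * hp t (j + 1)) = z ^ (s * hp t (j + 1)) * z ^ hp t (j + 1) := by
            rw [← pow_add]; congr 1; ring
          rw [e3]
          unfold WW
          have := one_sub_pow_ne t j hz
          field_simp
          ring
        rw [e2, ← e]
        ring
    rw [h1, PP_succ]
    ring
  have hL : HasSum (fun j => ∑ c ∈ Finset.Icc 1 r,
      z ^ c * ((-1) ^ j * (z ^ (t * c * hp t j) * PP t j z)))
      (∑ c ∈ Finset.Icc 1 r, z ^ c * aGF t (t * c) z 1 1 1) := by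
    apply hasSum_sum
    intro c _
    rw [aGF_eq]
    exact (summable_a t (t * c) ht hz).hasSum.mul_left _
  simp only [key] at hL
  have hb := (summable_b t ht hz).hasSum
  rw [← bGF_eq] at hb
  have ha := (summable_a t r ht hz).hasSum
  rw [← aGF_eq] at ha
  have ha2 := (hasSum_nat_add_iff' 1).mpr ha
  have := hL.unique (hb.add ha2)
  rw [this]
  simp [hp_zero, PP]
  ring

/-! ### Real estimates -/

def br (t : ℕ) (x : ℝ) : ℝ := ∑' j : ℕ, (-1) ^ j * pr t (j + 1) x

lemma bGF_ofReal (t : ℕ) (x : ℝ) : bGF t (x : ℂ) 1 1 1 = (br t x : ℂ) := by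
  rw [bGF_eq, br, Complex.ofReal_tsum]
  simp [PP_ofReal]

def ar (t r : ℕ) (x : ℝ) : ℝ := ∑' j : ℕ, (-1) ^ j * (x ^ (r * hp t j) * pr t j x)

lemma aGF_ofReal (t r : ℕ) (x : ℝ) : aGF t r (x : ℂ) 1 1 1 = (ar t r x : ℂ) := by
  rw [aGF_eq, ar, Complex.ofReal_tsum]
  simp [PP_ofReal]

lemma hasSum_br (t : ℕ) (ht : 2 ≤ t) {x : ℝ} (h0 : 0 < x) (h1 : x < 1) :
    HasSum (fun j : ℕ => (-1) ^ j * pr t (j + 1) x) (br t x) := by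
  apply Summable.hasSum
  apply Summable.of_norm_bounded ((summable_nat_add_iff 1).mpr (pr_summable t ht h0 h1))
  intro j
  simp [abs_of_pos (pr_pos t (j + 1) h0 h1)]

lemma hasSum_ar (t r : ℕ) (ht : 2 ≤ t) {x : ℝ} (h0 : 0 < x) (h1 : x < 1) :
    HasSum (fun j : ℕ => (-1) ^ j * (x ^ (r * hp t j) * pr t j x)) (ar t r x) := by
  apply Summable.hasSum
  apply Summable.of_norm_bounded (pr_summable t ht h0 h1)
  intro j
  have h2 : x ^ (r * hp t j) ≤ 1 := pow_le_one₀ h0.le h1.le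
  have h3 := pr_pos t j h0 h1
  simp only [norm_mul, norm_pow, norm_neg, norm_one, one_pow, one_mul, Real.norm_eq_abs,
    abs_of_pos h3, abs_of_pos h0]
  nlinarith

lemma br_bounds (t : ℕ) (ht : 2 ≤ t) {x : ℝ} (h0 : 0 < x) (h1 : x < 1) (h3 : wr t 3 x ≤ 1) :
    pr t 1 x - pr t 2 x ≤ br t x ∧ br t x ≤ pr t 1 x - pr t 2 x + pr t 3 x := by
  have hs := (hasSum_nat_add_iff' 1).mpr (hasSum_br t ht h0 h1)
  have hs2 := hs.neg
  simp only [Finset.range_one, Finset.sum_singleton, pow_zero, one_mul, zero_add] at hs2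
  have hs3 : HasSum (fun j : ℕ => (-1) ^ j * pr t (j + 2) x) (pr t 1 x - br t x) := by
    have e1 : (fun j : ℕ => (-1) ^ j * pr t (j + 2) x)
        = fun j : ℕ => -((-1) ^ (j + 1) * pr t (j + 1 + 1) x) := by
      ext j; rw [pow_succ]; ring
    have e2 : pr t 1 x - br t x = -(br t x - pr t 1 x) := by ring
    rw [e1, e2]
    exact hs2
  have hanti : Antitone (fun j : ℕ => pr t (j + 2) x) := by
    apply antitone_nat_of_succ_le
    intro j
    have h4 : wr t (j + 2 + 1) x ≤ wr t (2 + 1) x := wr_anti t h0 h1 (by omega)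
    have h5 := pr_pos t (j + 2) h0 h1
    show pr t (j + 2 + 1) x ≤ _
    rw [pr_succ]
    nlinarith
  have e1 := hanti.alternating_series_le_tendsto hs3.tendsto_sum_nat 1
  have e2 := hanti.tendsto_le_alternating_series hs3.tendsto_sum_nat 0
  simp [Finset.sum_range_succ] at e1 e2
  constructor <;> linarith

lemma br_gt_one (t : ℕ) (ht : 2 ≤ t) {x : ℝ} (h0 : 1 / 2 < x) (h1 : x < 1)
    (hx : x ^ (t + 1) * (3 * x - 1) < 2 * x - 1) : 1 < br t x := by
  have hx0 : 0 < x := by linarith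
  have hy0 : 0 < x ^ (t + 1) := by positivity
  have hy : x ^ (t + 1) < 1 / 2 := by nlinarith
  have hw2 : wr t 2 x ≤ 1 := by
    unfold wr
    rw [hp_two, div_le_one (by linarith)]
    linarith
  have hw3 : wr t 3 x ≤ 1 := (wr_anti t hx0 h1 (i := 1) (j := 2) (by omega)).trans hw2
  have hb := (br_bounds t ht hx0 h1 hw3).1
  refine lt_of_lt_of_le ?_ hb
  rw [pr_succ t 1, pr_succ t 0]
  simp only [pr, Finset.range_zero, Finset.prod_empty, zero_add, one_mul, wr, hp_one,
    one_add_one_eq_two, hp_two, pow_one]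
  have hp1 : 0 < 1 - x := by linarith
  have hp2 : 0 < 1 - x ^ (t + 1) := by linarith
  rw [show x / (1 - x) - x / (1 - x) * (x ^ (t + 1) / (1 - x ^ (t + 1)))
    = x * (1 - 2 * x ^ (t + 1)) / ((1 - x) * (1 - x ^ (t + 1))) by field_simp; ring]
  rw [one_lt_div (by positivity)]
  nlinarith

lemma numeric_right (t : ℕ) (ht : 2 ≤ t) :
    (1 - 0.72 / (t : ℝ)) ^ (t + 1) * (3 * (1 - 0.72 / (t : ℝ)) - 1)
      < 2 * (1 - 0.72 / (t : ℝ)) - 1 := by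
  rcases Nat.lt_or_ge t 3 with h | h
  · have : t = 2 := by omega
    subst this
    norm_num
  · have ht3 : (3 : ℝ) ≤ t := by exact_mod_cast h
    have h1 : (1 - 0.72 / (t : ℝ)) ^ t ≤ Real.exp (-0.72) :=
      Real.one_sub_div_pow_le_exp_neg (by linarith)
    have h2 : Real.exp (-0.72) ≤ 0.49 := by
      rw [Real.exp_neg]
      have h3 := Real.sum_le_exp_of_nonneg (x := 0.72) (by norm_num) 5
      have h4 : (1 : ℝ) / 0.49 ≤ Real.exp 0.72 := by
        refine le_trans ?_ h3
        simp [Finset.sum_range_succ, Nat.factorial]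
        norm_num
      rw [inv_le_comm₀ (Real.exp_pos _) (by norm_num)]
      simpa using h4
    set y := (1 : ℝ) / t with hy
    have e : 0.72 / (t : ℝ) = 0.72 * y := by rw [hy]; ring
    have hy0 : 0 < y := by positivity
    have hy1 : y ≤ 1 / 3 := by
      rw [hy]; exact one_div_le_one_div_of_le (by norm_num) ht3
    rw [e]
    have hA : 0 ≤ (1 - 0.72 * y) * (3 * (1 - 0.72 * y) - 1) := by
      apply mul_nonneg <;> linarith
    have h5 : (1 - 0.72 * y) ^ t ≤ 0.49 := by rw [← e]; exact h1.trans h2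
    rw [pow_succ, mul_assoc]
    calc _ ≤ 0.49 * ((1 - 0.72 * y) * (3 * (1 - 0.72 * y) - 1)) := by gcongr
      _ < _ := by nlinarith

lemma pow_57 (t : ℕ) (ht : 2 ≤ t) : ((t : ℝ) + 3) * (0.57 : ℝ) ^ (t + 1) < 1 := by
  induction t, ht using Nat.le_induction with
  | base => norm_num
  | succ t ht ih =>
    have : (2 : ℝ) ≤ t := by exact_mod_cast ht
    have h2 : (0 : ℝ) < 0.57 ^ (t + 1) := by positivity
    push_cast
    rw [pow_succ]
    nlinarith

lemma numeric_left (t : ℕ) (ht : 2 ≤ t) :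
    (0.57 : ℝ) ^ (t + 1) * (3 * 0.57 - 1) < 2 * 0.57 - 1 := by
  have h : (0.57 : ℝ) ^ (t + 1) ≤ 0.57 ^ 3 :=
    pow_le_pow_of_le_one (by norm_num) (by norm_num) (by omega)
  norm_num at *
  linarith

lemma frac_bounds (t : ℕ) (ht : 2 ≤ t) :
    0 < 0.72 / (t : ℝ) ∧ 0.72 / (t : ℝ) ≤ 0.36 := by
  have : (2 : ℝ) ≤ t := by exact_mod_cast ht
  refine ⟨by positivity, ?_⟩
  rw [div_le_iff₀ (by linarith)]
  linarith

lemma numeric_mid (t : ℕ) (ht : 2 ≤ t) {x : ℝ} (h1 : 0.57 ≤ x) (h2 : x ≤ 1 - 0.72 / (t : ℝ)) :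
    x ^ (t + 1) * (3 * x - 1) < 2 * x - 1 := by
  have hconv : ConvexOn ℝ (Set.Ici (1 / 2 : ℝ))
      ((fun x : ℝ => x ^ (t + 1)) * (fun x : ℝ => 3 * x - 1)) := by
    apply ConvexOn.mul
    · exact (convexOn_pow (t + 1)).subset
        (Set.Ici_subset_Ici.mpr (by norm_num)) (convex_Ici _)
    · refine ⟨convex_Ici _, ?_⟩
      intro a _ b _ c d _ _ hcd
      simp only [smul_eq_mul]
      nlinarith
    · intro x hx
      have : (1 / 2 : ℝ) ≤ x := hx
      have : 0 ≤ x := by linarith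
      positivity
    · intro x hx
      have : (1 / 2 : ℝ) ≤ x := hx
      show 0 ≤ 3 * x - 1
      linarith
    · intro a ha b hb hab
      have ha' : (1 / 2 : ℝ) ≤ a := ha
      simp only at hab
      exact pow_le_pow_left₀ (by linarith) (by linarith) _
  obtain ⟨f1, f2⟩ := frac_bounds t ht
  set y := 1 - 0.72 / (t : ℝ) with hy
  have hy1 : 0.64 ≤ y := by rw [hy]; linarith
  have hL := numeric_left t ht
  have hR := numeric_right t ht
  rw [← hy] at hR
  have hd : 0 < y - 0.57 := by norm_num at *; linarith
  have m1 : (0.57 : ℝ) ∈ Set.Ici (1 / 2 : ℝ) := by simp only [Set.mem_Ici]; norm_num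
  have m2 : y ∈ Set.Ici (1 / 2 : ℝ) := by simp only [Set.mem_Ici]; norm_num at *; linarith
  have hcx := hconv.2 m1 m2 
    (div_nonneg (sub_nonneg.mpr h2) hd.le) (div_nonneg (sub_nonneg.mpr h1) hd.le)
    (by field_simp; ring)
  have ex : (y - x) / (y - 0.57) * 0.57 + (x - 0.57) / (y - 0.57) * y = x := by
    field_simp; ring
  simp only [smul_eq_mul, Pi.mul_apply, ex] at hcx
  refine lt_of_le_of_lt hcx ?_
  set a := (y - x) / (y - 0.57) with ha
  set b := (x - 0.57) / (y - 0.57) with hb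
  have ha0 : 0 ≤ a := div_nonneg (by linarith) hd.le
  have hb0 : 0 ≤ b := div_nonneg (by linarith) hd.le
  have hab : a + b = 1 := by rw [ha, hb]; field_simp; ring
  have e3 : 2 * x - 1 = a * (2 * 0.57 - 1) + b * (2 * y - 1) := by
    linear_combination hab - 2 * ex
  rw [e3]
  rcases eq_or_lt_of_le ha0 with h | h
  · have hb1 : b = 1 := by linarith
    rw [← h, hb1]; linarith
  · have g1 := mul_lt_mul_of_pos_left hL h
    have g2 := mul_le_mul_of_nonneg_left hR.le hb0
    linarith

lemma q0_lt (t : ℕ) (ht : 2 ≤ t) {x : ℝ} (h2 : x < 1 - 0.72 / (t : ℝ))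
    (hb : br t x = 1) : x < 0.57 := by
  by_contra! h
  obtain ⟨f1, f2⟩ := frac_bounds t ht
  have := br_gt_one t ht (x := x) (by norm_num at *; linarith) (by linarith)
    (numeric_mid t ht h h2.le)
  linarith

/-- There is a second real zero of `1 - b` in the unit interval. -/
lemma exists_second_zero (t : ℕ) (ht : 2 ≤ t) :
    ∃ x : ℝ, 1 - 0.72 / (t : ℝ) ≤ x ∧ x < 1 ∧ br t x = 1 := by
  obtain ⟨f1, f2⟩ := frac_bounds t ht
  have hR := numeric_right t ht
  set y := 1 - 0.72 / (t : ℝ) with hy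
  have hy1 : 0.64 ≤ y := by rw [hy]; linarith
  have hyh : 1 / 2 < y := by norm_num at *; linarith
  have hy2 : y < 1 := by linarith
  have hby := br_gt_one t ht hyh hy2 hR
  have hypow : y ^ (t + 1) < 1 / 2 := by nlinarith [show 0 < y ^ (t + 1) by positivity]
  obtain ⟨x, hx0, hxp⟩ : ∃ x : ℝ, 0 < x ∧ x ^ (t + 1) = 1 / 2 := by
    refine ⟨(1 / 2 : ℝ) ^ (((t + 1 : ℕ) : ℝ)⁻¹), by positivity, ?_⟩
    exact Real.rpow_inv_natCast_pow (by norm_num) (by omega)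
  have hyx : y ≤ x := by
    have : y ^ (t + 1) < x ^ (t + 1) := by rw [hxp]; exact hypow
    exact (lt_of_pow_lt_pow_left₀ _ hx0.le this).le
  have hv : x < 2 ^ t / (2 ^ t + 1) := by
    apply lt_of_pow_lt_pow_left₀ (t + 1) (by positivity)
    rw [hxp]
    rcases Nat.lt_or_ge t 3 with h | h
    · have : t = 2 := by omega
      subst this
      norm_num
    · have h2 : 2 * ((t : ℝ) + 1) < 2 ^ t + 1 := by
        have : 2 * (t + 1) < 2 ^ t + 1 := by
          clear * - h
          induction t, h using Nat.le_induction with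
          | base => norm_num
          | succ t ht ih => rw [pow_succ]; omega
        exact_mod_cast this
      have h3 := one_add_mul_le_pow (a := -(1 / (2 ^ t + 1) : ℝ)) (by
        have : (1 / (2 ^ t + 1) : ℝ) ≤ 1 := by
          rw [div_le_one (by positivity)]
          have : (0 : ℝ) < 2 ^ t := by positivity
          linarith
        linarith) (t + 1)
      have e : (1 : ℝ) + -(1 / (2 ^ t + 1)) = 2 ^ t / (2 ^ t + 1) := by
        field_simp; ring
      rw [e] at h3
      refine lt_of_lt_of_le ?_ h3
      have : ((t : ℝ) + 1) / (2 ^ t + 1) < 1 / 2 := by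
        rw [div_lt_div_iff₀ (by positivity) (by norm_num)]
        linarith
      push_cast
      have e2 : ((t : ℝ) + 1) * -(1 / (2 ^ t + 1)) = -(((t : ℝ) + 1) / (2 ^ t + 1)) := by ring
      rw [e2]
      linarith
  have h2t : (0 : ℝ) < 2 ^ t := by positivity
  have hv' : x * (2 ^ t + 1) < 2 ^ t := by rwa [lt_div_iff₀ (by positivity)] at hv
  have hx1 : x < 1 := by nlinarith
  have hw2 : wr t 2 x = 1 := by
    unfold wr; rw [hp_two, hxp]; norm_num
  have hw3 : wr t 3 x ≤ 1 := (wr_anti t hx0 hx1 (i := 1) (j := 2) (by omega)).trans hw2.le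
  have hbx : br t x ≤ 1 := by
    refine (br_bounds t ht hx0 hx1 hw3).2.trans ?_
    rw [pr_succ t 2, pr_succ t 1, pr_succ t 0]
    norm_num [hw2, pr]
    unfold wr
    rw [hp_one, hp_three, pow_succ x (t * (t + 1)), mul_comm t, pow_mul, hxp, one_div, inv_pow,
      pow_one, div_mul_div_comm]
    have e0 : 0 < 1 - x := by linarith
    have e1 : x < 2 ^ t := by nlinarith
    have e2 : (2 ^ t : ℝ)⁻¹ * x < 1 := by
      rw [inv_mul_lt_iff₀ h2t]; linarith
    rw [div_le_one (mul_pos e0 (by linarith))]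
    have e3 : (2 ^ t : ℝ)⁻¹ * 2 ^ t = 1 := inv_mul_cancel₀ h2t.ne'
    have e4 : 0 < (2 ^ t : ℝ)⁻¹ := by positivity
    have := mul_lt_mul_of_pos_left hv' e4
    have e5 : (2 ^ t : ℝ)⁻¹ * (x * (2 ^ t + 1)) = x + (2 ^ t : ℝ)⁻¹ * x := by
      linear_combination x * e3
    rw [e5, e3] at this
    nlinarith
  have hcont : ContinuousOn (br t) (Set.Icc y x) := by
    intro w hw
    have hw1 : ‖(w : ℂ)‖ < 1 := by
      rw [Complex.norm_real, Real.norm_of_nonneg (by linarith [hw.1])]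
      exact hw.2.trans_lt hx1
    have c1 := (differentiableAt_b t ht hw1).continuousAt
    have c2 : ContinuousAt (fun w : ℝ => (bGF t (w : ℂ) 1 1 1).re) w :=
      Complex.continuous_re.continuousAt.comp
        (ContinuousAt.comp (f := fun w : ℝ => (w : ℂ)) c1 Complex.continuous_ofReal.continuousAt)
    simp only [bGF_ofReal, Complex.ofReal_re] at c2
    exact c2.continuousWithinAt
  obtain ⟨w, hw, hw2⟩ := intermediate_value_Icc' hyx hcont ⟨hbx, hby.le⟩
  exact ⟨w, hw.1, hw.2.trans_lt hx1, hw2⟩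

lemma ar_bounds (t r : ℕ) (ht : 2 ≤ t) (hr : 1 ≤ r) {x : ℝ} (h0 : 0 < x) (h1 : x < 0.57) :
    0.24 ≤ ar t r x ∧ ar t r x ≤ 1 := by
  have hx1 : x < 1 := by norm_num at *; linarith
  have hw1 : x * wr t 1 x ≤ 0.76 := by
    unfold wr
    rw [hp_one, pow_one, ← mul_div_assoc, div_le_iff₀ (by linarith)]
    norm_num at *
    nlinarith
  have hs := hasSum_ar t r ht h0 hx1
  have hstep : ∀ j, x ^ (r * hp t (j + 1)) * pr t (j + 1) x
      ≤ 0.76 * (x ^ (r * hp t j) * pr t j x) := by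
    intro j
    have e : hp t (j + 1) = hp t j + t ^ j := by simp [hp, Finset.sum_range_succ]
    have h2 : x ^ (r * t ^ j) ≤ x := by
      have : 1 ≤ r * t ^ j := Nat.mul_pos hr (pow_pos (by omega) j)
      simpa using pow_le_pow_of_le_one h0.le hx1.le this
    have h3 : wr t (j + 1) x ≤ wr t (0 + 1) x := wr_anti t h0 hx1 (by omega)
    have h4 : x ^ (r * t ^ j) * wr t (j + 1) x ≤ 0.76 :=
      (mul_le_mul h2 h3 (wr_pos t j h0 hx1).le h0.le).trans hw1
    rw [pr_succ, e, mul_add, pow_add]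
    have h5 : 0 < x ^ (r * hp t j) * pr t j x := mul_pos (by positivity) (pr_pos t j h0 hx1)
    nlinarith
  have hanti : Antitone (fun j : ℕ => x ^ (r * hp t j) * pr t j x) := by
    apply antitone_nat_of_succ_le
    intro j
    have := hstep j
    have h5 : 0 < x ^ (r * hp t j) * pr t j x := mul_pos (by positivity) (pr_pos t j h0 hx1)
    norm_num at *
    linarith
  have e1 := hanti.alternating_series_le_tendsto hs.tendsto_sum_nat 1
  have e2 := hanti.tendsto_le_alternating_series hs.tendsto_sum_nat 0
  have h6 := hstep 0
  simp [Finset.sum_range_succ, hp_zero, pr] at e1 e2 h6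
  norm_num at *
  constructor <;> linarith

/-! ### The derivative of `b` -/

def lr (t j : ℕ) (x : ℝ) : ℝ :=
  ∑ i ∈ Finset.range j, (hp t (i + 1) : ℝ) / (1 - x ^ hp t (i + 1))

lemma deriv_PP (t j : ℕ) {x : ℝ} (h0 : 0 < x) (h1 : x < 1) :
    HasDerivAt (PP t j) ((pr t j x * lr t j x / x : ℝ) : ℂ) (x : ℂ) := by
  have hx : ‖(x : ℂ)‖ < 1 := by rwa [Complex.norm_real, Real.norm_of_nonneg h0.le]
  have hxc : (x : ℂ) ≠ 0 := by exact_mod_cast h0.ne'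
  induction j with
  | zero =>
    have : PP t 0 = fun _ => 1 := by ext z; simp [PP]
    rw [this]
    simpa [lr] using hasDerivAt_const (x : ℂ) (1 : ℂ)
  | succ j ih =>
    have e : PP t (j + 1) = fun z => PP t j z * WW t (j + 1) z := by
      ext z; exact PP_succ t j z
    have hn := one_sub_pow_ne t j hx
    have hW : HasDerivAt (WW t (j + 1))
        ((wr t (j + 1) x * (hp t (j + 1) / (1 - x ^ hp t (j + 1))) / x : ℝ) : ℂ) (x : ℂ) := by
      unfold WW
      have hp1 := hasDerivAt_pow (hp t (j + 1)) (x : ℂ)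
      have := hp1.fun_div (hp1.const_sub 1) hn
      refine this.congr_deriv ?_
      obtain ⟨m, hm⟩ : ∃ m, hp t (j + 1) = m + 1 := ⟨_, (Nat.succ_pred_eq_of_pos
        (hp_succ_pos t j)).symm⟩
      unfold wr
      rw [hm] at hn ⊢
      push_cast
      try simp only [add_tsub_cancel_right]
      rw [pow_succ] at hn ⊢
      field_simp
      ring
    rw [e]
    refine (ih.fun_mul hW).congr_deriv ?_
    rw [PP_ofReal]
    have e2 : WW t (j + 1) (x : ℂ) = (wr t (j + 1) x : ℂ) := by simp [WW, wr]
    rw [e2, pr_succ]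
    simp only [lr, Finset.sum_range_succ]
    push_cast
    ring

lemma deriv_b_ne (t : ℕ) (ht : 2 ≤ t) {x : ℝ} (h0 : 0 < x) (h1 : x < 0.57) :
    deriv (fun q => bGF t q 1 1 1) (x : ℂ) ≠ 0 := by
  have hx1 : x < 1 := by norm_num at *; linarith
  have hx : ‖(x : ℂ)‖ < 1 := by rwa [Complex.norm_real, Real.norm_of_nonneg h0.le]
  have hs := hasSum_deriv_b t ht hx
  have e : ∀ j : ℕ, deriv (fun q => (-1) ^ j * PP t (j + 1) q) (x : ℂ)
      = (((-1) ^ j * (pr t (j + 1) x * lr t (j + 1) x / x) : ℝ) : ℂ) := by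
    intro j
    rw [((deriv_PP t (j + 1) h0 hx1).const_mul _).deriv]
    push_cast
    ring
  simp only [e] at hs
  have hs2 := Complex.hasSum_re hs
  simp only [Complex.ofReal_re] at hs2
  have hden : ∀ i, 0 < 1 - x ^ hp t (i + 1) := fun i => by
    have := pow_lt_one₀ h0.le hx1 (hp_succ_pos t i).ne'
    linarith
  have hterm : ∀ i, 0 < (hp t (i + 1) : ℝ) / (1 - x ^ hp t (i + 1)) := fun i => by
    have : (0 : ℝ) < hp t (i + 1) := by exact_mod_cast hp_succ_pos t i
    exact div_pos this (hden i)
  have hlpos : ∀ j, 0 < lr t (j + 1) x := fun j =>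
    Finset.sum_pos (fun i _ => hterm i) ⟨0, by simp⟩
  have ht0 : (2 : ℝ) ≤ t := by exact_mod_cast ht
  have hw2 : ((t : ℝ) + 2) * wr t 2 x < 1 := by
    unfold wr
    rw [hp_two]
    have h3 : x ^ (t + 1) ≤ 0.57 ^ (t + 1) := pow_le_pow_left₀ h0.le h1.le _
    have h4 := pow_57 t ht
    have h5 : ((t : ℝ) + 3) * x ^ (t + 1) < 1 := lt_of_le_of_lt (by gcongr) h4
    have h6 : 0 < 1 - x ^ (t + 1) := by have := hden 1; rwa [hp_two] at this
    rw [← mul_div_assoc, div_lt_one h6]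
    linarith
  have hl : ∀ j, lr t (j + 2) x ≤ ((t : ℝ) + 2) * lr t (j + 1) x := by
    intro j
    have e1 : lr t (j + 2) x = lr t (j + 1) x + (hp t (j + 2) : ℝ) / (1 - x ^ hp t (j + 2)) := by
      simp [lr, Finset.sum_range_succ]
    have e2 : (hp t (j + 1) : ℝ) / (1 - x ^ hp t (j + 1)) ≤ lr t (j + 1) x := by
      apply Finset.single_le_sum (f := fun i => (hp t (i + 1) : ℝ) / (1 - x ^ hp t (i + 1)))
        (fun i _ => (hterm i).le)
      simp
    have e3 : (hp t (j + 2) : ℝ) / (1 - x ^ hp t (j + 2))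
        ≤ ((t : ℝ) + 1) * ((hp t (j + 1) : ℝ) / (1 - x ^ hp t (j + 1))) := by
      rw [← mul_div_assoc]
      apply div_le_div₀ (by positivity)
      · have : hp t (j + 2) ≤ (t + 1) * hp t (j + 1) := by
          rw [hp_succ t (j + 1)]
          have := hp_succ_pos t j
          nlinarith
        exact_mod_cast this
      · exact hden j
      · have := pow_le_pow_of_le_one h0.le hx1.le (hp_mono t (show j + 1 ≤ j + 2 by omega))
        linarith
    have e4 := mul_le_mul_of_nonneg_left e2 (show 0 ≤ (t : ℝ) + 1 by positivity)
    rw [e1]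
    linarith
  have hstep : ∀ j, pr t (j + 2) x * lr t (j + 2) x / x
      < pr t (j + 1) x * lr t (j + 1) x / x := by
    intro j
    have hw : wr t (j + 1 + 1) x ≤ wr t (1 + 1) x := wr_anti t h0 hx1 (by omega)
    have hwp := wr_pos t (j + 1) h0 hx1
    have hpp := pr_pos t (j + 1) h0 hx1
    apply div_lt_div_of_pos_right _ h0
    rw [pr_succ t (j + 1), mul_assoc]
    apply mul_lt_mul_of_pos_left _ hpp
    calc _ ≤ wr t (j + 1 + 1) x * (((t : ℝ) + 2) * lr t (j + 1) x) := by
          gcongr; exact hl j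
      _ ≤ wr t 2 x * (((t : ℝ) + 2) * lr t (j + 1) x) := by
          have := hlpos j
          gcongr
      _ < _ := by nlinarith [hlpos j]
  have hanti : Antitone (fun j : ℕ => pr t (j + 1) x * lr t (j + 1) x / x) :=
    antitone_nat_of_succ_le fun j => (hstep j).le
  have e1 := hanti.alternating_series_le_tendsto hs2.tendsto_sum_nat 1
  simp only [mul_one, Finset.sum_range_succ, Finset.range_zero, Finset.sum_empty, pow_zero, pow_one,
    zero_add, one_mul] at e1
  have e5 := hstep 0
  norm_num at e1 e5
  intro hz
  rw [hz] at e1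
  simp at e1
  linarith

/-! ### The recursion for the forest numbers -/

lemma CanonicalForest.ext_levels {t r : ℕ} {S T : CanonicalForest t r}
    (h : S.levels = T.levels) : S = T := by
  cases S; cases T; simp only at h; subst h; rfl

instance forest_finite (t r n : ℕ) : Finite {T : CanonicalForest t r // T.size = n} := by
  refine Finite.of_injective
    (β := Composition n) (fun T => ⟨T.1.levels, fun {i} hi => T.1.pos i hi, T.2⟩) ?_
  intro S T h
  exact Subtype.ext (CanonicalForest.ext_levels (congrArg Composition.blocks h))

lemma forestCount_zero (t r : ℕ) : forestCount t r 0 = 1 := by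
  unfold forestCount
  rw [Nat.card_eq_one_iff_exists]
  refine ⟨⟨⟨[], by simp, by simp, List.isChain_nil⟩, by simp [CanonicalForest.size]⟩, ?_⟩
  rintro ⟨⟨l, h1, h2, h3⟩, h4⟩
  apply Subtype.ext
  apply CanonicalForest.ext_levels
  simp only [CanonicalForest.size] at h4
  cases l with
  | nil => rfl
  | cons a l =>
    have := h1 a (by simp)
    simp at h4
    omega

instance forest_finite' (t r n c : ℕ) :
    Finite {T : CanonicalForest t r // c + T.size = n} := by
  refine Finite.of_injective
    (β := {T : CanonicalForest t r // T.size = n - c})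
    (fun T => ⟨T.1, by have := T.2; omega⟩) ?_
  intro S T h
  simp only [Subtype.mk.injEq] at h
  exact Subtype.ext h

def forestCons (t r n : ℕ) :
    (Σ c : {c // c ∈ Finset.Icc 1 r}, {T : CanonicalForest t (t * c.1) // c.1 + T.size = n}) →
      {T : CanonicalForest t r // T.size = n} :=
  fun p => ⟨⟨p.1.1 :: p.2.1.levels, by
    intro c hc
    rcases List.mem_cons.mp hc with h | h
    · have := (Finset.mem_Icc.mp p.1.2).1
      omega
    · exact p.2.1.pos c h, by
    intro c hc
    simp at hc
    have := (Finset.mem_Icc.mp p.1.2).2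
    omega, List.isChain_cons.mpr ⟨p.2.1.head_le, p.2.1.chain⟩⟩, by
    have := p.2.2
    simpa [CanonicalForest.size] using this⟩

lemma forestCount_rec (t r n : ℕ) (hn : n ≠ 0) :
    forestCount t r n = ∑ c ∈ Finset.Icc 1 r,
      if c ≤ n then forestCount t (t * c) (n - c) else 0 := by
  have hbij : Function.Bijective (forestCons t r n) := by
    constructor
    · rintro ⟨⟨c, hc⟩, ⟨S, hS⟩⟩ ⟨⟨d, hd⟩, ⟨T, hT⟩⟩ h
      have h' : c :: S.levels = d :: T.levels := congrArg (fun X => X.1.levels) h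
      obtain ⟨h1, h2⟩ := List.cons.inj h'
      subst h1
      have := CanonicalForest.ext_levels h2
      subst this
      rfl
    · rintro ⟨⟨l, h1, h2, h3⟩, h4⟩
      simp only [CanonicalForest.size] at h4
      cases l with
      | nil => simp at h4; omega
      | cons a l =>
        have h3' := List.isChain_cons.mp h3
        refine ⟨⟨⟨a, Finset.mem_Icc.mpr ⟨h1 a (by simp), h2 a (by simp)⟩⟩,
          ⟨⟨l, fun c hc => h1 c (by simp [hc]), h3'.1, h3'.2⟩, ?_⟩⟩, ?_⟩
        · simpa [CanonicalForest.size] using h4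
        · rfl
  have h := Nat.card_eq_of_bijective _ hbij
  unfold forestCount
  rw [← h, Nat.card_sigma, ← Finset.sum_coe_sort (Finset.Icc 1 r)]
  apply Finset.sum_congr rfl
  rintro ⟨c, hc⟩ _
  simp only
  split_ifs with hcn
  · apply Nat.card_congr
    exact Equiv.subtypeEquivRight fun T => by omega
  · rw [Nat.card_eq_zero]
    left
    refine ⟨fun T => ?_⟩
    have := T.2
    omega

/-! ### Power series coefficients -/

def HC (f : ℂ → ℂ) (c : ℕ → ℂ) : Prop :=
  ∀ᶠ z in nhds (0 : ℂ), HasSum (fun n => z ^ n * c n) (f z)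

lemma HC_iff (f : ℂ → ℂ) (c : ℕ → ℂ) :
    HC f c ↔ HasFPowerSeriesAt f (FormalMultilinearSeries.ofScalars ℂ c) 0 := by
  rw [hasFPowerSeriesAt_iff]
  simp [HC, FormalMultilinearSeries.coeff_ofScalars]

lemma HC.unique {f : ℂ → ℂ} {c d : ℕ → ℂ} (h1 : HC f c) (h2 : HC f d) : c = d := by
  rw [HC_iff] at h1 h2
  have h := h1.eq_formalMultilinearSeries h2
  ext n
  have := congrArg (fun p => p.coeff n) h
  simpa [FormalMultilinearSeries.coeff_ofScalars] using this

lemma HC.congr {f g : ℂ → ℂ} {c : ℕ → ℂ} (h1 : HC f c)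
    (h : ∀ᶠ z in nhds (0 : ℂ), f z = g z) : HC g c := by
  filter_upwards [h1, h] with z hz hz2
  rwa [← hz2]

lemma HC.add {f g : ℂ → ℂ} {c d : ℕ → ℂ} (h1 : HC f c) (h2 : HC g d) :
    HC (fun z => f z + g z) (fun n => c n + d n) := by
  filter_upwards [h1, h2] with z hz hz2
  simpa [mul_add] using HasSum.add hz hz2

lemma HC.sum {ι : Type*} (s : Finset ι) {f : ι → ℂ → ℂ} {c : ι → ℕ → ℂ}
    (h : ∀ i ∈ s, HC (f i) (c i)) :
    HC (fun z => ∑ i ∈ s, f i z) (fun n => ∑ i ∈ s, c i n) := by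
  have h' : ∀ᶠ z in nhds (0 : ℂ), ∀ i ∈ s, HasSum (fun n => z ^ n * c i n) (f i z) :=
    (Finset.eventually_all s).mpr h
  filter_upwards [h'] with z hz
  simp only [Finset.mul_sum]
  exact hasSum_sum hz

lemma HC.one : HC (fun _ => 1) (fun n => if n = 0 then 1 else 0) := by
  refine Eventually.of_forall fun z => ?_
  convert! hasSum_ite_eq (0 : ℕ) (1 : ℂ) using 1
  ext n
  by_cases hn : n = 0 <;> simp [hn]

lemma HC.pow_mul {f : ℂ → ℂ} {c : ℕ → ℂ} (h1 : HC f c) (k : ℕ) :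
    HC (fun z => z ^ k * f z) (fun n => if k ≤ n then c (n - k) else 0) := by
  filter_upwards [h1] with z hz
  have h2 := hz.mul_left (z ^ k)
  rw [← hasSum_nat_add_iff' k]
  have e : ∑ i ∈ Finset.range k, z ^ i * (if k ≤ i then c (i - k) else 0) = 0 := by
    apply Finset.sum_eq_zero
    intro i hi
    rw [if_neg (by simpa using hi), mul_zero]
  rw [e, sub_zero]
  have e2 : (fun n => z ^ (n + k) * (if k ≤ n + k then c (n + k - k) else 0))
      = fun n => z ^ k * (z ^ n * c n) := by
    ext n
    rw [if_pos (by omega), Nat.add_sub_cancel, pow_add]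
    ring
  rw [e2]
  exact h2

lemma HC.pole (q A : ℂ) (hq : q ≠ 0) :
    HC (fun z => A / (z - q)) (fun n => -A / q / q ^ n) := by
  have : ∀ᶠ z in nhds (0 : ℂ), ‖z‖ < ‖q‖ := by
    have := Metric.ball_mem_nhds (0 : ℂ) (norm_pos_iff.mpr hq)
    filter_upwards [this] with z hz
    simpa using hz
  filter_upwards [this] with z hz
  have h1 : ‖z / q‖ < 1 := by
    rw [norm_div, div_lt_one (norm_pos_iff.mpr hq)]; exact hz
  have h2 := (hasSum_geometric_of_norm_lt_one h1).mul_left (-A / q)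
  have hne : z - q ≠ 0 := by
    intro h
    rw [sub_eq_zero.mp h] at hz
    exact lt_irrefl _ hz
  have hne2 : q - z ≠ 0 := by
    intro h
    apply hne
    linear_combination -h
  have e1 : A / (z - q) = -A / q * (1 - z / q)⁻¹ := by
    rw [show 1 - z / q = (q - z) / q by field_simp, inv_div,
      show z - q = -(q - z) by ring]
    field_simp
  have e2 : (fun n : ℕ => z ^ n * (-A / q / q ^ n)) = fun n : ℕ => -A / q * (z / q) ^ n := by
    ext n
    rw [div_pow]
    ring
  rw [e1, e2]
  exact h2

lemma HC.of_analytic {f : ℂ → ℂ} (hf : AnalyticAt ℂ f 0) :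
    HC f (fun n => iteratedDeriv n f 0 / n.factorial) :=
  (HC_iff _ _).mpr hf.hasFPowerSeriesAt

lemma count_eq_of_rec (t : ℕ) (g : ℕ → ℕ → ℂ)
    (hg : ∀ r n, g r n = (if n = 0 then 1 else 0)
      + ∑ c ∈ Finset.Icc 1 r, if c ≤ n then g (t * c) (n - c) else 0) :
    ∀ n r, (forestCount t r n : ℂ) = g r n := by
  intro n
  induction n using Nat.strong_induction_on with
  | _ n ih =>
    intro r
    rw [hg]
    by_cases hn : n = 0
    · subst hn
      rw [forestCount_zero, Finset.sum_eq_zero]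
      · simp
      · intro c hc
        have := (Finset.mem_Icc.mp hc).1
        rw [if_neg (by omega)]
    · rw [forestCount_rec t r n hn, if_neg hn, zero_add]
      push_cast
      apply Finset.sum_congr rfl
      intro c hc
      have := (Finset.mem_Icc.mp hc).1
      split_ifs with h
      · rw [ih (n - c) (by omega)]
      · rfl

lemma radius_lt_one (t : ℕ) (ht : 2 ≤ t) (q₀ : ℝ) (hq₀lt : q₀ < 1 - 0.72 / t)
    (Q : ℝ) (hQdom : ∀ q : ℂ, ‖q‖ ≤ q₀ / Q → bGF t q 1 1 1 = 1 → q = (q₀ : ℂ)) :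
    q₀ / Q < 1 := by
  by_contra! h
  obtain ⟨x, hx1, hx2, hx3⟩ := exists_second_zero t ht
  obtain ⟨f1, f2⟩ := frac_bounds t ht
  have hx0 : 0 ≤ x := by norm_num at *; linarith
  have e := hQdom (x : ℂ) (by
    rw [Complex.norm_real, Real.norm_of_nonneg hx0]; linarith) (by rw [bGF_ofReal, hx3]; simp)
  have e2 : x = q₀ := by exact_mod_cast e
  linarith

lemma nu_bounds (t : ℕ) (ht : 2 ≤ t) (q₀ : ℝ) (h0 : 0 < q₀) (h57 : q₀ < 0.57) (r : ℕ)
    (hr : 1 ≤ r) :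
    0.24 / (q₀ * ‖deriv (fun q : ℂ => bGF t q 1 1 1) (q₀ : ℂ)‖) ≤ ‖nuGF t r q₀‖ ∧
    ‖nuGF t r q₀‖ ≤ 1 / (q₀ * ‖deriv (fun q : ℂ => bGF t q 1 1 1) (q₀ : ℂ)‖) := by
  obtain ⟨h1, h2⟩ := ar_bounds t r ht hr h0 h57
  have hd : 0 < ‖deriv (fun q : ℂ => bGF t q 1 1 1) (q₀ : ℂ)‖ :=
    norm_pos_iff.mpr (deriv_b_ne t ht h0 h57)
  have hpos : 0 ≤ ar t r q₀ := by norm_num at *; linarith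
  unfold nuGF
  rw [aGF_ofReal, norm_div, norm_mul, Complex.norm_real, Complex.norm_real,
    Real.norm_of_nonneg hpos, Real.norm_of_nonneg h0.le]
  constructor <;> gcongr

lemma coeff_main (t : ℕ) (ht : 2 ≤ t)
    (q₀ : ℝ) (h0 : 0 < q₀) (h57 : q₀ < 0.57)
    (hroot : bGF t (q₀ : ℂ) 1 1 1 = 1)
    (R : ℝ) (hR : q₀ < R) (hR1 : R < 1)
    (hdom : ∀ q : ℂ, ‖q‖ ≤ R → bGF t q 1 1 1 = 1 → q = (q₀ : ℂ)) :
    ∃ M : ℝ, 0 < M ∧ ∀ r n : ℕ,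
      ‖(forestCount t r n : ℂ) - nuGF t r q₀ / (q₀ : ℂ) ^ n‖ ≤ M / R ^ n := by
  have hR0 : 0 < R := h0.trans hR
  have hqc : (q₀ : ℂ) ≠ 0 := by exact_mod_cast h0.ne'
  have hqn : ‖(q₀ : ℂ)‖ = q₀ := by rw [Complex.norm_real, Real.norm_of_nonneg h0.le]
  set S : Set ℂ := Metric.closedBall 0 R with hS
  have memS : ∀ z, z ∈ S ↔ ‖z‖ ≤ R := fun z => by simp [hS]
  have hSq : S ∈ nhds (q₀ : ℂ) := by
    apply Filter.mem_of_superset (Metric.isOpen_ball.mem_nhds (show (q₀ : ℂ) ∈ Metric.ball 0 R by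
      rw [mem_ball_zero_iff, hqn]; exact hR)) Metric.ball_subset_closedBall
  have hS0 : S ∈ nhds (0 : ℂ) := Metric.closedBall_mem_nhds _ hR0
  have hqS : (q₀ : ℂ) ∈ S := (memS _).mpr (by rw [hqn]; exact hR.le)
  set f : ℂ → ℂ := fun z => 1 - bGF t z 1 1 1 with hf
  have hfd : DifferentiableOn ℂ f S := fun z hz =>
    ((differentiableAt_b t ht (((memS z).mp hz).trans_lt hR1)).const_sub 1).differentiableWithinAt
  have hf0 : f q₀ = 0 := by simp [hf, hroot]
  set k : ℂ → ℂ := dslope f q₀ with hk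
  have hkd : DifferentiableOn ℂ k S := (Complex.differentiableOn_dslope hSq).mpr hfd
  have hfk : ∀ z, f z = (z - q₀) * k z := by
    intro z
    have := sub_smul_dslope f (q₀ : ℂ) z
    rw [hf0, sub_zero, smul_eq_mul] at this
    exact this.symm
  have hkq : k q₀ = -deriv (fun q : ℂ => bGF t q 1 1 1) (q₀ : ℂ) := by
    rw [hk, dslope_same, hf, deriv_const_sub]
  have hkne : ∀ z ∈ S, k z ≠ 0 := by
    intro z hz hkz
    by_cases hzq : z = q₀
    · rw [hzq, hkq] at hkz
      exact deriv_b_ne t ht h0 h57 (neg_eq_zero.mp hkz)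
    · apply hzq
      apply hdom z ((memS z).mp hz)
      have := hfk z
      rw [hkz, mul_zero] at this
      exact (sub_eq_zero.mp this).symm
  have hScomp : IsCompact S := isCompact_closedBall _ _
  obtain ⟨z₀, hz₀, hmin⟩ := hScomp.exists_isMinOn ⟨_, hqS⟩ hkd.continuousOn.norm
  set m := ‖k z₀‖ with hm
  have hm0 : 0 < m := norm_pos_iff.mpr (hkne z₀ hz₀)
  have hmk : ∀ z ∈ S, m ≤ ‖k z‖ := fun z hz => hmin hz
  set B := ∑' j, pr t j R with hB
  have hB0 : 0 < B := (pr_summable t ht hR0 hR1).tsum_pos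
    (fun j => (pr_pos t j hR0 hR1).le) 0 (pr_pos t 0 hR0 hR1)
  let A : ℕ → ℂ → ℂ := fun r z => aGF t r z 1 1 1 / k z
  have hAd : ∀ r, DifferentiableOn ℂ (A r) S := fun r =>
    DifferentiableOn.fun_div (fun z hz => (differentiableAt_a t r ht
      (((memS z).mp hz).trans_lt hR1)).differentiableWithinAt) hkd hkne
  have hAb : ∀ r, ∀ z ∈ S, ‖A r z‖ ≤ B / m := by
    intro r z hz
    simp only [A, norm_div]
    exact div_le_div₀ hB0.le (norm_a_le t r ht hR0 ((memS z).mp hz) hR1) hm0 (hmk z hz)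
  let D : ℕ → ℂ → ℂ := fun r => dslope (A r) q₀
  have hDd : ∀ r, DifferentiableOn ℂ (D r) S := fun r =>
    (Complex.differentiableOn_dslope hSq).mpr (hAd r)
  have hDb : ∀ r, ∀ z ∈ Metric.sphere (0 : ℂ) R, ‖D r z‖ ≤ 2 * (B / m) / (R - q₀) := by
    intro r z hz
    have hzR : ‖z‖ = R := by simpa using hz
    have hzS : z ∈ S := (memS z).mpr hzR.le
    have hdist : R - q₀ ≤ ‖z - q₀‖ := by
      have := norm_sub_norm_le z (q₀ : ℂ)
      rwa [hzR, hqn] at this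
    have hne : z - q₀ ≠ 0 := norm_pos_iff.mp (by linarith)
    have e : D r z = (A r z - A r q₀) / (z - q₀) := by
      have := sub_smul_dslope (A r) (q₀ : ℂ) z
      rw [smul_eq_mul] at this
      rw [← this]
      field_simp
      rfl
    rw [e, norm_div]
    refine div_le_div₀ (by positivity) ?_ (by linarith) hdist
    refine (norm_sub_le _ _).trans ?_
    linarith [hAb r z hzS, hAb r _ hqS]
  have hDc : ∀ r n, ‖iteratedDeriv n (D r) 0 / (n.factorial : ℂ)‖
      ≤ 2 * (B / m) / (R - q₀) / R ^ n := by
    intro r n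
    have hd : DiffContOnCl ℂ (D r) (Metric.ball 0 R) :=
      (hDd r).diffContOnCl_ball subset_rfl
    have := Complex.norm_iteratedDeriv_le_of_forall_mem_sphere_norm_le n hR0 hd (hDb r)
    have hfac : (0 : ℝ) < n.factorial := by exact_mod_cast n.factorial_pos
    rw [norm_div, Complex.norm_natCast, div_le_iff₀ hfac]
    calc _ ≤ _ := this
      _ = _ := by ring
  let g : ℕ → ℕ → ℂ := fun r n =>
    iteratedDeriv n (D r) 0 / (n.factorial : ℂ) + nuGF t r q₀ / (q₀ : ℂ) ^ n
  have hnear : ∀ᶠ z in nhds (0 : ℂ), ‖z‖ < q₀ := by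
    filter_upwards [Metric.ball_mem_nhds (0 : ℂ) h0] with z hz
    simpa using hz
  have hfne : ∀ z : ℂ, ‖z‖ < q₀ → f z ≠ 0 := by
    intro z hz h
    have := hdom z (hz.le.trans hR.le) (sub_eq_zero.mp h).symm
    rw [this, hqn] at hz
    exact lt_irrefl _ hz
  have hHC : ∀ r, HC (fun z => aGF t r z 1 1 1 / f z) (g r) := by
    intro r
    have h1 : HC (D r) _ := HC.of_analytic ((hDd r).analyticAt hS0)
    have h2 := HC.pole (q₀ : ℂ) (A r q₀) hqc
    have h3 := h1.add h2
    have e : ∀ n : ℕ, -A r q₀ / q₀ / (q₀ : ℂ) ^ n = nuGF t r q₀ / (q₀ : ℂ) ^ n := by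
      intro n
      congr 1
      simp only [A, nuGF, hkq]
      rw [div_neg, neg_neg, div_div, mul_comm]
    simp only [e] at h3
    refine h3.congr ?_
    filter_upwards [hnear] with z hz
    have hfz := hfne z hz
    rw [hfk z] at hfz ⊢
    obtain ⟨n1, n2⟩ := mul_ne_zero_iff.mp hfz
    have := sub_smul_dslope (A r) (q₀ : ℂ) z
    rw [smul_eq_mul] at this
    have e3 : D r z + A r q₀ / (z - q₀) = A r z / (z - q₀) := by
      rw [eq_div_iff n1, add_mul, div_mul_cancel₀ _ n1]
      linear_combination this
    rw [e3]
    simp only [A]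
    rw [div_div, mul_comm (k z)]
  have hrec : ∀ r n, g r n = (if n = 0 then 1 else 0)
      + ∑ c ∈ Finset.Icc 1 r, if c ≤ n then g (t * c) (n - c) else 0 := by
    intro r
    have h1 := HC.one.add (HC.sum (Finset.Icc 1 r) (fun c _ => (hHC (t * c)).pow_mul c))
    have h2 := h1.congr (g := fun z => aGF t r z 1 1 1 / f z) (by
      filter_upwards [hnear] with z hz
      have hfz := hfne z hz
      have hz1 : ‖z‖ < 1 := hz.trans (hR.trans hR1)
      rw [a_functional t r ht hz1, add_div, Finset.sum_div]
      congr 1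
      · exact (div_self hfz).symm
      · exact Finset.sum_congr rfl fun c _ => (mul_div_assoc _ _ _).symm)
    have h3 := (hHC r).unique h2
    intro n
    exact congrFun h3 n
  have hcount := count_eq_of_rec t g hrec
  refine ⟨2 * (B / m) / (R - q₀), ?_, ?_⟩
  · have : 0 < R - q₀ := by linarith
    positivity
  · intro r n
    rw [hcount n r]
    simp only [g, add_sub_cancel_right]
    exact hDc r n

/-- `ν(r) = Θ(1)` uniformly in `r ≥ 1`, and the number of canonical
`t`-ary forests with `r` roots and `n` internal vertices is `(ν(r)/q₀ⁿ)(1 + O(Qⁿ))`,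
uniformly in `r ≥ 1`. -/
theorem forest_count_asymptotics (t : ℕ) (ht : 2 ≤ t)
    (q₀ : ℝ) (hq₀pos : 0 < q₀) (hq₀lt : q₀ < 1 - 0.72 / t)
    (hq₀root : bGF t (q₀ : ℂ) 1 1 1 = 1)
    (Q : ℝ) (hQpos : 0 < Q) (hQlt : Q < 1)
    (hQdom : ∀ q : ℂ, ‖q‖ ≤ q₀ / Q → bGF t q 1 1 1 = 1 → q = (q₀ : ℂ)) :
    (∃ c₁ c₂ : ℝ, 0 < c₁ ∧ 0 < c₂ ∧
      ∀ r : ℕ, 1 ≤ r → c₁ ≤ ‖nuGF t r q₀‖ ∧ ‖nuGF t r q₀‖ ≤ c₂) ∧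
    ∃ C : ℝ, 0 < C ∧ ∀ r : ℕ, 1 ≤ r → ∀ n : ℕ,
      ‖(forestCount t r n : ℂ) - nuGF t r q₀ / (q₀ : ℂ) ^ n‖
        ≤ C * (‖nuGF t r q₀‖ / q₀ ^ n) * Q ^ n := by
  have hbr : br t q₀ = 1 := by
    rw [bGF_ofReal] at hq₀root
    exact_mod_cast hq₀root
  have h57 : q₀ < 0.57 := q0_lt t ht hq₀lt hbr
  have hR1 := radius_lt_one t ht q₀ hq₀lt Q hQdom
  have hR : q₀ < q₀ / Q := by
    rw [lt_div_iff₀ hQpos]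
    nlinarith
  have hd : 0 < ‖deriv (fun q : ℂ => bGF t q 1 1 1) (q₀ : ℂ)‖ :=
    norm_pos_iff.mpr (deriv_b_ne t ht hq₀pos h57)
  have hnu := nu_bounds t ht q₀ hq₀pos h57
  set c₁ := 0.24 / (q₀ * ‖deriv (fun q : ℂ => bGF t q 1 1 1) (q₀ : ℂ)‖) with hc₁
  have hc₁pos : 0 < c₁ := by positivity
  refine ⟨⟨c₁, _, hc₁pos, by positivity, hnu⟩, ?_⟩
  obtain ⟨M, hM, hbound⟩ := coeff_main t ht q₀ hq₀pos h57 hq₀root (q₀ / Q) hR hR1 hQdom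
  refine ⟨M / c₁, by positivity, ?_⟩
  intro r hr n
  refine (hbound r n).trans ?_
  have h1 := (hnu r hr).1
  have e : M / (q₀ / Q) ^ n = M / c₁ * (c₁ / q₀ ^ n) * Q ^ n := by
    rw [div_pow]
    field_simp
  rw [e]
  gcongr

end
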